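/- Let G be a finite simple graph on vertex set {x_{11}, …, x_{n1}} with no isolated vertex. Let C_1, …, C_m (0 ≤ m ≤ n) be cycle graphs with x_{i1} ∈ V(C_i), and let G_{m+1}, …, G_n be connected chordal graphs with at least two vertices such that x_{i1} is a neighbor of a simplicial vertex of G_i for each i = m+1, …, n. Set G' = G(C_1, …, C_m, G_{m+1}, …, G_n). Then G' is vertex decomposable if and only if every cycle C_i (1 ≤ i ≤ m) has length 3 or 5. -/

import Mathlib

variable {V : Type*} [DecidableEq V]

/-- `S` is an independent set of the induced subgraph of `G` on the vertex set `A`. -/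
def IsIndepIn (G : SimpleGraph V) (A S : Finset V) : Prop :=
  S ⊆ A ∧ ∀ u ∈ S, ∀ v ∈ S, ¬G.Adj u v

/-- `S` is a maximal independent set of the induced subgraph of `G` on the vertex set `A`. -/
def IsMaxIndepIn (G : SimpleGraph V) (A S : Finset V) : Prop :=
  IsIndepIn G A S ∧ ∀ T, IsIndepIn G A T → S ⊆ T → S = T

/-- The induced subgraph of `G` on `A` is unmixed: all maximal independent sets
have the same cardinality. -/
def UnmixedOn (G : SimpleGraph V) (A : Finset V) : Prop :=
  ∀ S T, IsMaxIndepIn G A S → IsMaxIndepIn G A T → S.card = T.card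

open scoped Classical in
/-- The vertex set `A \ N_G[x]`. -/
noncomputable def delClosedNbhd (G : SimpleGraph V) (A : Finset V) (x : V) : Finset V :=
  A.filter fun y => y ≠ x ∧ ¬G.Adj x y

/-- The induced subgraph of `G` on `A` is vertex decomposable. -/
inductive VertexDecomposableOn (G : SimpleGraph V) : Finset V → Prop
  | edgeless (A : Finset V) (h : ∀ u ∈ A, ∀ v ∈ A, ¬G.Adj u v) : VertexDecomposableOn G A
  | shed (A : Finset V) (x : V) (hx : x ∈ A)
      (hlink : VertexDecomposableOn G (delClosedNbhd G A x))
      (hdel : VertexDecomposableOn G (A.erase x))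
      (hexch : ∀ S, IsIndepIn G (delClosedNbhd G A x) S →
        ∃ y ∈ A, G.Adj x y ∧ IsIndepIn G (A.erase x) (insert y S)) :
      VertexDecomposableOn G A

/-- `x` is a shedding vertex of the induced subgraph of `G` on `A`. -/
def IsSheddingVertexOn (G : SimpleGraph V) (A : Finset V) (x : V) : Prop :=
  x ∈ A ∧
  VertexDecomposableOn G (delClosedNbhd G A x) ∧
  VertexDecomposableOn G (A.erase x) ∧
  ∀ S, IsIndepIn G (delClosedNbhd G A x) S →
    ∃ y ∈ A, G.Adj x y ∧ IsIndepIn G (A.erase x) (insert y S)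

/-- The independence complex of the induced subgraph of `G` on `A` is shellable:
there is an ordering `F 0, F 1, …` of its facets (the maximal independent sets) such
that for every `i`, every face of the subcomplex `(⋃ j < i, ⟨F j⟩) ∩ ⟨F i⟩` is contained
in a face of that subcomplex of cardinality `(F i).card - 1` (i.e. the subcomplex is
pure of dimension `dim (F i) - 1`). -/
def ShellableOn (G : SimpleGraph V) (A : Finset V) : Prop :=
  ∃ (t : ℕ) (F : Fin t → Finset V),
    Function.Injective F ∧
    (∀ S, IsMaxIndepIn G A S ↔ ∃ i, F i = S) ∧
    ∀ i : Fin t, ∀ S : Finset V, S ⊆ F i → (∃ j, j < i ∧ S ⊆ F j) →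
      ∃ S' : Finset V, S ⊆ S' ∧ S' ⊆ F i ∧ (∃ j, j < i ∧ S' ⊆ F j) ∧
        S'.card = (F i).card - 1

/-- A graph is chordal if every cycle of length at least four has a chord, i.e. an
edge of the graph joining two vertices of the cycle that is not an edge of the cycle. -/
def IsChordal (G : SimpleGraph V) : Prop :=
  ∀ (x : V) (w : G.Walk x x), w.IsCycle → 4 ≤ w.length →
    ∃ u v, u ∈ w.support ∧ v ∈ w.support ∧ G.Adj u v ∧ s(u, v) ∉ w.edges

/-- The induced subgraph of `G` on `A` is a cycle graph on `m` vertices. -/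
def IsCycleGraphOn (G : SimpleGraph V) (A : Finset V) (m : ℕ) : Prop :=
  (∀ u v, G.Adj u v → u ∈ A ∧ v ∈ A) ∧
  Nonempty (G.induce (A : Set V) ≃g SimpleGraph.cycleGraph m)

/-- The independence number of the induced subgraph of `G` on `A`. -/
noncomputable def indepNumOn (G : SimpleGraph V) (A : Finset V) : ℕ :=
  sSup {k | ∃ S, IsIndepIn G A S ∧ S.card = k}


lemma mem_dcn {G : SimpleGraph V} {A : Finset V} {x y : V} :
    y ∈ delClosedNbhd G A x ↔ y ∈ A ∧ y ≠ x ∧ ¬ G.Adj x y := by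
  simp [delClosedNbhd]

/-- Links of vertex decomposable graphs are vertex decomposable. -/
lemma vd_link {G : SimpleGraph V} {A : Finset V} (h : VertexDecomposableOn G A) :
    ∀ y ∈ A, VertexDecomposableOn G (delClosedNbhd G A y) := by
  induction h with
  | edgeless A h =>
    intro y _
    refine .edgeless _ fun u hu v hv => h u (mem_dcn.1 hu).1 v (mem_dcn.1 hv).1
  | shed A x hx hlink hdel hexch ih1 ih2 =>
    intro y hy
    by_cases hyx : y = x
    · subst hyx; exact hlink
    by_cases hadj : G.Adj y x
    · have := ih2 y (Finset.mem_erase.2 ⟨hyx, hy⟩)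
      convert this using 1
      ext u
      simp only [mem_dcn, Finset.mem_erase]
      constructor
      · rintro ⟨h1, h2, h3⟩
        refine ⟨⟨?_, h1⟩, h2, h3⟩
        rintro rfl; exact h3 hadj
      · rintro ⟨⟨_, h1⟩, h2, h3⟩
        exact ⟨h1, h2, h3⟩
    · have hadj' : ¬ G.Adj x y := fun h => hadj h.symm
      refine .shed _ x (mem_dcn.2 ⟨hx, Ne.symm hyx, hadj⟩) ?_ ?_ ?_
      · have := ih1 y (mem_dcn.2 ⟨hy, hyx, hadj'⟩)
        convert this using 1
        ext u
        simp only [mem_dcn]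
        tauto
      · have := ih2 y (Finset.mem_erase.2 ⟨hyx, hy⟩)
        convert this using 1
        ext u
        simp only [mem_dcn, Finset.mem_erase]
        tauto
      · intro S hS
        have hS1 : ∀ s ∈ S, s ∈ A ∧ (s ≠ y ∧ ¬ G.Adj y s) ∧ s ≠ x ∧ ¬ G.Adj x s := by
          intro s hs
          have := hS.1 hs
          simp only [mem_dcn] at this
          tauto
        obtain ⟨z, hz, hxz, hI⟩ := hexch (insert y S) (by
          refine ⟨?_, ?_⟩
          · intro s hs
            rw [mem_dcn]
            rcases Finset.mem_insert.1 hs with rfl | hs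
            · exact ⟨hy, hyx, hadj'⟩
            · exact ⟨(hS1 s hs).1, (hS1 s hs).2.2⟩
          · intro u hu v hv
            rcases Finset.mem_insert.1 hu with h1 | h1 <;>
            rcases Finset.mem_insert.1 hv with h2 | h2
            · rw [h1, h2]; exact G.irrefl
            · rw [h1]; exact (hS1 v h2).2.1.2
            · rw [h2]; exact fun h => (hS1 u h1).2.1.2 h.symm
            · exact hS.2 u h1 v h2)
        have hzy : ¬ G.Adj y z := hI.2 y (by simp) z (by simp)
        have hzy' : z ≠ y := by rintro rfl; exact hadj' hxz
        refine ⟨z, mem_dcn.2 ⟨hz, hzy', hzy⟩, hxz, ?_, ?_⟩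
        · intro s hs
          rw [Finset.mem_erase, mem_dcn]
          rcases Finset.mem_insert.1 hs with rfl | hs
          · exact ⟨hxz.ne', hz, hzy', hzy⟩
          · have := hS1 s hs
            tauto
        · intro u hu v hv
          apply hI.2
          · simp only [Finset.mem_insert] at hu ⊢; tauto
          · simp only [Finset.mem_insert] at hv ⊢; tauto

/-- A vertex decomposable disjoint union has vertex decomposable pieces. -/
lemma vd_part {G : SimpleGraph V} (C : Finset V) : ∀ (k : ℕ) (A : Finset V), A.card ≤ k →
    VertexDecomposableOn G A → C ⊆ A →
    (∀ u ∈ C, ∀ v ∈ A, v ∉ C → ¬ G.Adj u v) → VertexDecomposableOn G C := by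
  intro k
  induction k with
  | zero =>
    intro A hA h hC _
    have : A = ∅ := by simpa using hA
    subst this
    rwa [Finset.subset_empty.1 hC]
  | succ k ih =>
    intro A hA h hC hno
    by_cases hAC : A ⊆ C
    · rwa [Finset.Subset.antisymm hC hAC]
    obtain ⟨d, hd, hdC⟩ := Finset.not_subset.1 hAC
    refine ih (delClosedNbhd G A d) ?_ (vd_link h d hd) ?_ ?_
    · have : (delClosedNbhd G A d) ⊆ A.erase d := by
        intro u hu
        rw [mem_dcn] at hu
        exact Finset.mem_erase.2 ⟨hu.2.1, hu.1⟩
      have := Finset.card_le_card this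
      rw [Finset.card_erase_of_mem hd] at this
      omega
    · intro u hu
      refine mem_dcn.2 ⟨hC hu, ?_, fun h => hno u hu d hd hdC h.symm⟩
      rintro rfl; exact hdC hu
    · intro u hu v hv
      exact hno u hu v (mem_dcn.1 hv).1

def restr (G : SimpleGraph V) (T : Set V) : SimpleGraph V where
  Adj u v := G.Adj u v ∧ u ∈ T ∧ v ∈ T
  symm := ⟨fun _ _ h => ⟨h.1.symm, h.2.2, h.2.1⟩⟩
  loopless := ⟨fun _ h => G.irrefl h.1⟩

/-- No chordless cycle, in the form used for the proof of Dirac's theorem. -/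
def NoHole (G : SimpleGraph V) (A : Finset V) : Prop :=
  ∀ v ∈ A, ∀ a ∈ A, ∀ b ∈ A, ∀ D ⊆ A, (∀ d ∈ D, d ≠ v ∧ ¬ G.Adj v d) → a ≠ b → ¬ G.Adj a b →
    G.Adj v a → G.Adj v b → ¬ (restr G {u | u ∈ D ∨ u = a ∨ u = b}).Reachable a b

lemma NoHole.mono {G : SimpleGraph V} {A A' : Finset V} (h : NoHole G A) (hA : A' ⊆ A) :
    NoHole G A' := fun v hv a ha b hb D hD =>
  h v (hA hv) a (hA ha) b (hA hb) D (hD.trans hA)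

lemma noHole_of_chordal {G : SimpleGraph V} (h : IsChordal G) (A : Finset V) : NoHole G A := by
  intro v _ a _ b _ D _ hD hab hnab hva hvb hr
  set T : Set V := {u | u ∈ D ∨ u = a ∨ u = b} with hT
  have hvT : v ∉ T := by
    rintro (h | h | h)
    · exact (hD v h).1 rfl
    · exact hva.ne h
    · exact hvb.ne h
  obtain ⟨p, hp, hlen⟩ := hr.exists_path_of_dist
  have hle : restr G T ≤ G := fun _ _ h => h.1
  have hsupp : ∀ u ∈ p.support, u ∈ T := by
    have : ∀ {a b : V} (p : (restr G T).Walk a b), a ∈ T → ∀ u ∈ p.support, u ∈ T := by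
      intro a b p
      induction p with
      | nil => intro ha u hu; simp at hu; rwa [hu]
      | cons hadj q ih =>
        intro ha u hu
        rw [SimpleGraph.Walk.support_cons, List.mem_cons] at hu
        rcases hu with rfl | hu
        · exact ha
        · exact ih hadj.2.2 u hu
    exact this p (by simp [hT])
  have hsuppq : (p.mapLe hle).support = p.support := by simp
  have hedgeq : (p.mapLe hle).edges = p.edges := by simp
  have hvq : v ∉ (p.mapLe hle).support := by rw [hsuppq]; exact fun h => hvT (hsupp v h)
  have hq : (p.mapLe hle).IsPath := by simpa using hp
  have hlen2 : 2 ≤ p.length := by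
    rcases Nat.lt_or_ge p.length 2 with hl | hl
    · exfalso
      interval_cases hh : p.length
      · exact hab (SimpleGraph.Walk.eq_of_length_eq_zero hh)
      · exact hnab (SimpleGraph.Walk.adj_of_length_eq_one hh).1
    · exact hl
  set q := p.mapLe hle with hqd
  have hcyc : (SimpleGraph.Walk.cons hva (q.concat hvb.symm)).IsCycle := by
    rw [SimpleGraph.Walk.cons_isCycle_iff]
    refine ⟨hq.concat hvq _, ?_⟩
    rw [SimpleGraph.Walk.edges_concat]
    intro hm
    simp only [List.concat_eq_append, List.mem_append, List.mem_singleton] at hm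
    rcases hm with hm | hm
    · exact hvq (SimpleGraph.Walk.fst_mem_support_of_mem_edges _ hm)
    · simp only [Sym2.eq_iff] at hm
      rcases hm with ⟨h1, h2⟩ | ⟨h1, h2⟩
      · exact hvb.ne h1
      · exact hab h2
  obtain ⟨u, w, hu, hw, huw, hne⟩ := h v _ hcyc (by
    simp [hqd]; omega)
  simp only [SimpleGraph.Walk.support_cons, SimpleGraph.Walk.support_concat, List.concat_eq_append,
    List.mem_cons, List.mem_append, List.not_mem_nil, or_false,
    SimpleGraph.Walk.edges_cons, SimpleGraph.Walk.edges_concat, not_or, hsuppq, hedgeq] at hu hw hne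
  have key1 : ∀ w, G.Adj v w → w ∈ T → w = a ∨ w = b := by
    intro w h1 h2
    rcases h2 with h2 | h2
    · exact absurd h1 (hD w h2).2
    · exact h2
  have hu' : u = v ∨ u ∈ p.support := by tauto
  have hw' : w = v ∨ w ∈ p.support := by tauto
  clear hu hw
  rcases hu' with rfl | hu
  · rcases hw' with rfl | hw
    · exact G.irrefl huw
    · rcases key1 w huw (hsupp w hw) with rfl | rfl
      · exact hne.1 rfl
      · exact hne.2.2 Sym2.eq_swap
  rcases hw' with rfl | hw
  · rcases key1 u huw.symm (hsupp u hu) with rfl | rfl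
    · exact hne.1 Sym2.eq_swap
    · exact hne.2.2 rfl
  have key : ∀ i j, i < j → j ≤ p.length → G.Adj (p.getVert i) (p.getVert j) →
      s(p.getVert i, p.getVert j) ∈ p.edges := by
    intro i j hij hj hadj
    by_cases hij' : j = i + 1
    · subst hij'
      exact (SimpleGraph.Walk.mk_mem_edges_iff_exists p).2 ⟨i, by omega, rfl⟩
    · exfalso
      have hadj' : (restr G T).Adj (p.getVert i) (p.getVert j) :=
        ⟨hadj, hsupp _ (p.getVert_mem_support _), hsupp _ (p.getVert_mem_support _)⟩
      have := SimpleGraph.dist_le ((p.take i).append (.cons hadj' (p.drop j)))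
      simp at this
      omega
  obtain ⟨i, rfl, hi⟩ := SimpleGraph.Walk.mem_support_iff_exists_getVert.1 hu
  obtain ⟨j, rfl, hj⟩ := SimpleGraph.Walk.mem_support_iff_exists_getVert.1 hw
  rcases lt_trichotomy i j with hij | hij | hij
  · exact hne.2.1 (key i j hij hj huw)
  · subst hij; exact G.irrefl huw
  · exact hne.2.1 (by rw [Sym2.eq_swap]; exact key j i hij hi huw.symm)

/-- `w` is simplicial in the induced subgraph on `A`. -/
def SimplOn (G : SimpleGraph V) (A : Finset V) (w : V) : Prop :=
  w ∈ A ∧ ∀ u ∈ A, ∀ v ∈ A, G.Adj w u → G.Adj w v → u ≠ v → G.Adj u v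

/-- Dirac's theorem. -/
lemma dirac {G : SimpleGraph V} : ∀ (k : ℕ) (A : Finset V), A.card ≤ k → NoHole G A →
    ∀ v ∈ A, (∃ u ∈ A, u ≠ v ∧ ¬ G.Adj v u) → ∃ w, SimplOn G A w ∧ w ≠ v ∧ ¬ G.Adj v w := by
  classical
  intro k
  induction k with
  | zero =>
    intro A hA _ v hv
    have : A = ∅ := by simpa using hA
    subst this
    simp at hv
  | succ k ih =>
    rintro A hA hH v hv ⟨c, hc, hcv, hvc⟩
    set D := delClosedNbhd G A v with hD
    have hcD : c ∈ D := mem_dcn.2 ⟨hc, hcv, hvc⟩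
    set C := D.filter (fun u => (restr G (D : Set V)).Reachable c u) with hC
    set S := A.filter (fun s => s ∉ D ∧ ∃ u ∈ C, G.Adj s u) with hS
    have hcC : c ∈ C := by simp [hC, hcD]
    have hCD : ∀ u ∈ C, u ∈ D := fun u hu => (Finset.mem_filter.1 hu).1
    have hSv : ∀ s ∈ S, G.Adj v s := by
      intro s hs
      obtain ⟨h1, h2, u, hu, hsu⟩ := Finset.mem_filter.1 hs
      rw [hD, mem_dcn] at h2
      by_contra hcon
      by_cases hsv : s = v
      · subst hsv
        exact (mem_dcn.1 (hCD u hu)).2.2 hsu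
      · exact h2 ⟨h1, hsv, hcon⟩
    -- neighbours of `C` lie in `C ∪ S`
    have hnb : ∀ u ∈ C, ∀ w ∈ A, G.Adj u w → w ∈ C ∪ S := by
      intro u hu w hw huw
      rw [Finset.mem_union]
      by_cases hwD : w ∈ D
      · left
        refine Finset.mem_filter.2 ⟨hwD, (Finset.mem_filter.1 hu).2.trans ?_⟩
        exact SimpleGraph.Adj.reachable ⟨huw, hCD u hu, hwD⟩
      · right
        exact Finset.mem_filter.2 ⟨hw, hwD, u, hu, huw.symm⟩
    have hSclique : ∀ a ∈ S, ∀ b ∈ S, a ≠ b → G.Adj a b := by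
      intro a ha b hb hab
      by_contra hnab
      obtain ⟨haA, haD, c1, hc1, hac1⟩ := Finset.mem_filter.1 ha
      obtain ⟨hbA, hbD, c2, hc2, hbc2⟩ := Finset.mem_filter.1 hb
      refine hH v hv a haA b hbA D (Finset.filter_subset _ _)
        (fun d hd => (mem_dcn.1 hd).2) hab hnab (hSv a ha) (hSv b hb) ?_
      have hmono : restr G (D : Set V) ≤ restr G {u | u ∈ D ∨ u = a ∨ u = b} :=
        fun p q h => ⟨h.1, Or.inl h.2.1, Or.inl h.2.2⟩
      have h12 := ((Finset.mem_filter.1 hc1).2.symm.trans (Finset.mem_filter.1 hc2).2).mono hmono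
      have e1 : (restr G {u | u ∈ D ∨ u = a ∨ u = b}).Adj a c1 :=
        ⟨hac1, Or.inr (Or.inl rfl), Or.inl (hCD _ hc1)⟩
      have e2 : (restr G {u | u ∈ D ∨ u = a ∨ u = b}).Adj c2 b :=
        ⟨hbc2.symm, Or.inl (hCD _ hc2), Or.inr (Or.inr rfl)⟩
      exact e1.reachable.trans (h12.trans e2.reachable)
    have hCSA : C ∪ S ⊆ A := by
      intro u hu
      rcases Finset.mem_union.1 hu with hu | hu
      · exact (mem_dcn.1 (hCD u hu)).1
      · exact (Finset.mem_filter.1 hu).1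
    have hfin : ∀ w ∈ C, SimplOn G (C ∪ S) w → ∃ w, SimplOn G A w ∧ w ≠ v ∧ ¬ G.Adj v w := by
      intro w hw hsw
      refine ⟨w, ⟨hCSA hsw.1, ?_⟩, (mem_dcn.1 (hCD w hw)).2⟩
      intro p hp q hq hwp hwq
      exact hsw.2 p (hnb w hw p hp hwp) q (hnb w hw q hq hwq) hwp hwq
    have hvCS : v ∉ C ∪ S := by
      intro h
      rcases Finset.mem_union.1 h with h | h
      · exact (mem_dcn.1 (hCD v h)).2.1 rfl
      · exact G.irrefl (hSv v h)
    have hcard : (C ∪ S).card ≤ k := by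
      have : C ∪ S ⊂ A := ⟨hCSA, fun h => hvCS (h hv)⟩
      have := Finset.card_lt_card this
      omega
    by_cases hcl : ∀ p ∈ C ∪ S, ∀ q ∈ C ∪ S, q ≠ p → G.Adj p q
    · refine hfin c hcC ⟨Finset.mem_union_left _ hcC, ?_⟩
      intro p hp q hq _ _ hpq
      exact hcl p hp q hq hpq.symm
    · push Not at hcl
      obtain ⟨p, hp, q, hq, hqp, hpq⟩ := hcl
      obtain ⟨w, hw, hwp, hpw⟩ := ih (C ∪ S) hcard (hH.mono hCSA) p hp ⟨q, hq, hqp, hpq⟩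
      rcases Finset.mem_union.1 hw.1 with hwC | hwS
      · exact hfin w hwC hw
      · obtain ⟨w', hw', hwp', hpw'⟩ := ih (C ∪ S) hcard (hH.mono hCSA) w hw.1
          ⟨p, hp, hwp.symm, fun h => hpw h.symm⟩
        rcases Finset.mem_union.1 hw'.1 with hwC | hwS'
        · exact hfin w' hwC hw'
        · exact absurd (hSclique w hwS w' hwS' hwp'.symm) hpw'

lemma exists_simpl {G : SimpleGraph V} {A : Finset V} (hA : A.Nonempty) (h : NoHole G A) :
    ∃ w, SimplOn G A w := by
  by_cases hcl : ∀ p ∈ A, ∀ q ∈ A, q ≠ p → G.Adj p q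
  · obtain ⟨c, hc⟩ := hA
    exact ⟨c, hc, fun p hp q hq _ _ hpq => hcl p hp q hq hpq.symm⟩
  · push Not at hcl
    obtain ⟨p, hp, q, hq, hqp, hpq⟩ := hcl
    obtain ⟨w, hw, _⟩ := dirac _ A le_rfl h p hp ⟨q, hq, hqp, hpq⟩
    exact ⟨w, hw⟩

/-- Chordal graphs are vertex decomposable. -/
lemma vd_of_noHole {G : SimpleGraph V} : ∀ (k : ℕ) (A : Finset V), A.card ≤ k → NoHole G A →
    VertexDecomposableOn G A := by
  classical
  intro k
  induction k with
  | zero =>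
    intro A hA _
    have : A = ∅ := by simpa using hA
    subst this
    exact .edgeless _ (by simp)
  | succ k ih =>
    intro A hA hH
    by_cases he : ∀ u ∈ A, ∀ v ∈ A, ¬G.Adj u v
    · exact .edgeless _ he
    push Not at he
    obtain ⟨u, hu, v, hv, huv⟩ := he
    set A' := A.filter (fun a => ∃ b ∈ A, G.Adj a b) with hA'
    obtain ⟨w, hw, hws⟩ := exists_simpl (A := A') ⟨u, Finset.mem_filter.2 ⟨hu, v, hv, huv⟩⟩
      (hH.mono (Finset.filter_subset _ _))
    obtain ⟨hwA, y, hy, hwy⟩ := Finset.mem_filter.1 hw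
    have hlt : (A.erase y).card ≤ k := by
      rw [Finset.card_erase_of_mem hy]; omega
    have hsub : delClosedNbhd G A y ⊆ A.erase y := by
      intro a ha
      rw [mem_dcn] at ha
      exact Finset.mem_erase.2 ⟨ha.2.1, ha.1⟩
    refine .shed A y hy (ih _ ((Finset.card_le_card hsub).trans hlt)
      (hH.mono (hsub.trans (Finset.erase_subset _ _))))
      (ih _ hlt (hH.mono (Finset.erase_subset _ _))) ?_
    intro S hS
    have hwS : ∀ s ∈ S, ¬ G.Adj w s := by
      intro s hs hws'
      obtain ⟨h1, h2, h3⟩ := mem_dcn.1 (hS.1 hs)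
      exact h3 (hws y (Finset.mem_filter.2 ⟨hy, w, hwA, hwy.symm⟩) s
        (Finset.mem_filter.2 ⟨h1, w, hwA, hws'.symm⟩) hwy hws' h2.symm)
    refine ⟨w, hwA, hwy.symm, ?_, ?_⟩
    · intro s hs
      rcases Finset.mem_insert.1 hs with rfl | hs
      · exact Finset.mem_erase.2 ⟨hwy.ne, hwA⟩
      · exact hsub (hS.1 hs)
    · intro a ha b hb
      rcases Finset.mem_insert.1 ha with h1 | h1 <;> rcases Finset.mem_insert.1 hb with h2 | h2
      · rw [h1, h2]; exact G.irrefl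
      · rw [h1]; exact hwS b h2
      · rw [h2]; exact fun h => hwS a h1 h.symm
      · exact hS.2 a h1 b h2

/-- Local data of an attached graph `K` on `B` at the attaching vertex `x`. -/
def Good (K : SimpleGraph V) (B : Finset V) (x : V) : Prop :=
  (∀ S ⊆ B, (∀ s ∈ S, s ≠ x ∧ ¬ K.Adj x s) → (∀ u ∈ S, ∀ v ∈ S, ¬ K.Adj u v) →
    ∃ y ∈ B, K.Adj x y ∧ ∀ s ∈ S, ¬ K.Adj y s) ∧ NoHole K (B.erase x)

lemma good_of_chordal {K : SimpleGraph V} {B : Finset V} {x : V} (h : IsChordal K)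
    (hz : ∃ z ∈ B, (∀ u v, K.Adj z u → K.Adj z v → u ≠ v → K.Adj u v) ∧ K.Adj z x) :
    Good K B x := by
  refine ⟨?_, noHole_of_chordal h _⟩
  obtain ⟨z, hzB, hs, hzx⟩ := hz
  intro S _ hS _
  exact ⟨z, hzB, hzx.symm, fun s hsS hadj =>
    (hS s hsS).2 (hs x s hzx hadj (hS s hsS).1.symm)⟩

lemma cyc_param {K : SimpleGraph V} {B : Finset V} {m : ℕ} (h : IsCycleGraphOn K B m) :
    ∃ f : Fin m → V, (∀ i, f i ∈ B) ∧ (∀ u ∈ B, ∃ i, f i = u) ∧ Function.Injective f ∧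
      ∀ i j, K.Adj (f i) (f j) ↔ (SimpleGraph.cycleGraph m).Adj i j := by
  obtain ⟨_, ⟨e⟩⟩ := h
  refine ⟨fun i => (e.symm i : V), fun i => (e.symm i).2, ?_, ?_, ?_⟩
  · intro u hu
    exact ⟨e ⟨u, hu⟩, by simp⟩
  · intro i j hij
    exact e.symm.injective (Subtype.ext hij)
  · intro i j
    rw [← e.symm.map_adj_iff]
    rfl

lemma good_cycle3 {K : SimpleGraph V} {B : Finset V} {x : V} (hx : x ∈ B)
    (h : IsCycleGraphOn K B 3) : Good K B x := by
  obtain ⟨f, hfB, hfs, hfi, hadj⟩ := cyc_param h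
  have hall : ∀ u ∈ B, ∀ v ∈ B, u ≠ v → K.Adj u v := by
    intro u hu v hv huv
    obtain ⟨i, rfl⟩ := hfs u hu
    obtain ⟨j, rfl⟩ := hfs v hv
    rw [hadj, SimpleGraph.cycleGraph_three_eq_top]
    exact fun hij => huv (congrArg f hij)
  refine ⟨?_, ?_⟩
  · intro S hSB hS _
    obtain ⟨i, rfl⟩ := hfs x hx
    refine ⟨f (i + 1), hfB _, hall _ (hfB _) _ (hfB _) (fun hh => ?_), ?_⟩
    · have := hfi hh
      clear * - this
      revert i; decide
    · intro s hs
      exact absurd (hall _ (hfB i) s (hSB hs) (hS s hs).1.symm) (hS s hs).2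
  · intro v _ a ha b hb D _ _ hab hnab
    exact absurd (hall a (Finset.mem_of_mem_erase ha) b (Finset.mem_of_mem_erase hb) hab) hnab

set_option synthInstance.maxHeartbeats 400000 in
set_option synthInstance.maxSize 2000 in
set_option maxRecDepth 100000 in
set_option maxHeartbeats 4000000 in
lemma c5_aux : ∀ x v a b : Fin 5, v ≠ x → a ≠ x → b ≠ x → a ≠ b → v - a = 1 ∨ a - v = 1 →
    v - b = 1 ∨ b - v = 1 → (¬ (b = a ∨ b - a = 1 ∨ a - b = 1)) ∧
    ∀ u, u ≠ x → u ≠ v → (u = a ∨ u - a = 1 ∨ a - u = 1) → ∀ w, w ≠ x → w ≠ v →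
    (u - w = 1 ∨ w - u = 1) → (w = a ∨ w - a = 1 ∨ a - w = 1) := by
  decide

lemma good_cycle5 {K : SimpleGraph V} {B : Finset V} {x : V} (hx : x ∈ B)
    (h : IsCycleGraphOn K B 5) : Good K B x := by
  obtain ⟨f, hfB, hfs, hfi, hadj⟩ := cyc_param h
  have hadj' : ∀ i j : Fin 5, K.Adj (f i) (f j) ↔ (i - j = 1 ∨ j - i = 1) := by
    intro i j
    rw [hadj]
    exact SimpleGraph.cycleGraph_adj
  obtain ⟨x0, rfl⟩ := hfs x hx
  refine ⟨?_, ?_⟩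
  · intro S hSB hS hSI
    by_contra hcon
    push Not at hcon
    obtain ⟨s, hs, h1⟩ := hcon (f (x0 + 1)) (hfB _) ((hadj' _ _).2 (by simp))
    obtain ⟨s', hs', h2⟩ := hcon (f (x0 - 1)) (hfB _) ((hadj' _ _).2 (by simp))
    obtain ⟨i, rfl⟩ := hfs s (hSB hs)
    obtain ⟨j, rfl⟩ := hfs s' (hSB hs')
    have hi : i ≠ x0 := fun h => (hS _ hs).1 (congrArg f h)
    have hj : j ≠ x0 := fun h => (hS _ hs').1 (congrArg f h)
    have hij := hSI _ hs _ hs'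
    rw [hadj'] at hij h1 h2
    clear * - hi hj hij h1 h2
    revert x0 i j
    decide
  · intro v hv a ha b hb D hD hDv hab hnab hva hvb hr
    rw [Finset.mem_erase] at hv ha hb
    obtain ⟨v0, rfl⟩ := hfs v hv.2
    obtain ⟨a0, rfl⟩ := hfs a ha.2
    obtain ⟨b0, rfl⟩ := hfs b hb.2
    obtain ⟨haux1, haux2⟩ := c5_aux x0 v0 a0 b0 (fun h => hv.1 (congrArg f h))
      (fun h => ha.1 (congrArg f h)) (fun h => hb.1 (congrArg f h))
      (fun h => hab (congrArg f h)) ((hadj' _ _).1 hva) ((hadj' _ _).1 hvb)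
    set T : Set V := {u | u ∈ D ∨ u = f a0 ∨ u = f b0} with hT
    have hT1 : ∀ w, f w ∈ T → w ≠ x0 ∧ w ≠ v0 := by
      rintro w (h | h | h)
      · refine ⟨?_, ?_⟩
        · rintro rfl; exact (Finset.mem_erase.1 (hD h)).1 rfl
        · rintro rfl; exact (hDv _ h).1 rfl
      · have := hfi h; subst this
        exact ⟨fun h => ha.1 (congrArg f h), fun h => hva.ne (congrArg f h.symm)⟩
      · have := hfi h; subst this
        exact ⟨fun h => hb.1 (congrArg f h), fun h => hvb.ne (congrArg f h.symm)⟩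
    have key : ∀ {p q : V} (W : (restr K T).Walk p q) (u w : Fin 5), p = f u → q = f w →
        (u = a0 ∨ u - a0 = 1 ∨ a0 - u = 1) → (w = a0 ∨ w - a0 = 1 ∨ a0 - w = 1) := by
      intro p q W
      induction W with
      | nil => intro u w h1 h2 h3; rwa [← hfi (h1.symm.trans h2)]
      | cons hpq W ih =>
        rename_i p' q' r'
        intro u w h1 h2 h3
        obtain ⟨hK, hp, hq⟩ := hpq
        obtain ⟨y, hy⟩ := hfs q' (h.1 _ _ hK).2
        refine ih y w hy.symm h2 ?_
        subst h1 hy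
        exact haux2 u (hT1 u hp).1 (hT1 u hp).2 h3 y (hT1 y hq).1 (hT1 y hq).2 ((hadj' _ _).1 hK)
    obtain ⟨W⟩ := hr
    exact haux1 (key W a0 b0 rfl rfl (Or.inl rfl))

open Fin.CommRing in
lemma not_vd_cycle {H K : SimpleGraph V} {B : Finset V} {m : ℕ} (hm : 3 ≤ m) (hm3 : m ≠ 3)
    (hm5 : m ≠ 5) (h : IsCycleGraphOn K B m)
    (hHK : ∀ u ∈ B, ∀ v ∈ B, (H.Adj u v ↔ K.Adj u v)) : ¬ VertexDecomposableOn H B := by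
  obtain ⟨f, hfB, hfs, hfi, hadj⟩ := cyc_param h
  obtain ⟨k, rfl⟩ : ∃ k, m = k + 2 + 2 := ⟨m - 4, by omega⟩
  have hadj' : ∀ i j : Fin (k + 2 + 2), H.Adj (f i) (f j) ↔ (i - j = 1 ∨ j - i = 1) := by
    intro i j
    rw [hHK _ (hfB _) _ (hfB _), hadj]
    exact SimpleGraph.cycleGraph_adj
  have n1 : (1 : Fin (k + 2 + 2)) ≠ 0 := by
    simp
  have n2 : (2 : Fin (k + 2 + 2)) ≠ 0 := by
    have : 2 % (k + 2 + 2) = 2 := Nat.mod_eq_of_lt (by omega)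
    rw [Ne, Fin.ext_iff]
    simp [this]
  have n3 : (3 : Fin (k + 2 + 2)) ≠ 0 := by
    have : 3 % (k + 2 + 2) = 3 := Nat.mod_eq_of_lt (by omega)
    rw [Ne, Fin.ext_iff]
    simp [this]
  have n5 : (5 : Fin (k + 2 + 2)) ≠ 0 := by
    rw [Ne, Fin.ext_iff]
    rcases Nat.eq_zero_or_pos k with rfl | hk
    · decide
    · have : 5 % (k + 2 + 2) = 5 := Nat.mod_eq_of_lt (by omega)
      simp [this]
  intro hvd
  cases hvd with
  | edgeless _ he =>
    exact he _ (hfB 0) _ (hfB 1) ((hadj' _ _).2 (by simp))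
  | shed _ v hv _ _ hex =>
    obtain ⟨v0, rfl⟩ := hfs v hv
    have e1 : f (v0 + 2) ∈ delClosedNbhd H B (f v0) := by
      refine mem_dcn.2 ⟨hfB _, fun h => n2 ?_, ?_⟩
      · simpa using hfi h
      · rw [hadj']
        rintro (h | h)
        · exact n3 (by linear_combination -h)
        · exact n1 (by linear_combination h)
    have e2 : f (v0 - 2) ∈ delClosedNbhd H B (f v0) := by
      refine mem_dcn.2 ⟨hfB _, fun h => n2 ?_, ?_⟩
      · simpa using hfi h
      · rw [hadj']
        rintro (h | h)
        · exact n1 (by linear_combination h)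
        · exact n3 (by linear_combination -h)
    have e3 : ¬ H.Adj (f (v0 + 2)) (f (v0 - 2)) := by
      rw [hadj']
      rintro (h | h)
      · exact n3 (by linear_combination h)
      · exact n5 (by linear_combination -h)
    obtain ⟨y, hy, hvy, hI⟩ := hex {f (v0 + 2), f (v0 - 2)} (by
      refine ⟨?_, ?_⟩
      · intro s hs
        rcases Finset.mem_insert.1 hs with rfl | hs
        · exact e1
        · rw [Finset.mem_singleton.1 hs]; exact e2
      · intro a ha b hb
        simp only [Finset.mem_insert, Finset.mem_singleton] at ha hb
        rcases ha with rfl | rfl <;> rcases hb with rfl | rfl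
        · exact H.irrefl
        · exact e3
        · exact fun h => e3 h.symm
        · exact H.irrefl)
    obtain ⟨y0, rfl⟩ := hfs y hy
    rcases (hadj' _ _).1 hvy with h1 | h1
    · refine hI.2 (f y0) (by simp) (f (v0 - 2)) (by simp) ((hadj' _ _).2 (Or.inl ?_))
      linear_combination -h1
    · refine hI.2 (f y0) (by simp) (f (v0 + 2)) (by simp) ((hadj' _ _).2 (Or.inr ?_))
      linear_combination -h1

section attach
variable {n : ℕ} {x : Fin n → V} {B : Fin n → Finset V} {G H : SimpleGraph V}
  {Gs : Fin n → SimpleGraph V}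

lemma att_idx (hBdisj : ∀ i j, i ≠ j → Disjoint (B i) (B j)) {i j : Fin n} {u : V}
    (hi : u ∈ B i) (hj : u ∈ B j) : i = j := by
  by_contra hne
  exact Finset.disjoint_left.1 (hBdisj i j hne) hi hj

lemma att_off (hGsupp : ∀ u v, G.Adj u v → (∃ i, u = x i) ∧ (∃ j, v = x j))
    (hxB : ∀ i, x i ∈ B i) (hBdisj : ∀ i j, i ≠ j → Disjoint (B i) (B j))
    (hsup : ∀ i u v, (Gs i).Adj u v → u ∈ B i ∧ v ∈ B i)
    (hH : ∀ u v, H.Adj u v ↔ G.Adj u v ∨ ∃ i, (Gs i).Adj u v)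
    {i : Fin n} {u v : V} (hu : u ∈ B i) (hux : u ≠ x i) (h : H.Adj u v) : (Gs i).Adj u v := by
  rcases (hH u v).1 h with h | ⟨j, h⟩
  · obtain ⟨⟨j, rfl⟩, _⟩ := hGsupp u v h
    have := att_idx hBdisj hu (hxB j)
    subst this
    exact absurd rfl hux
  · have := att_idx hBdisj hu (hsup j u v h).1
    subst this
    exact h

lemma att_in (hGsupp : ∀ u v, G.Adj u v → (∃ i, u = x i) ∧ (∃ j, v = x j))
    (hxB : ∀ i, x i ∈ B i) (hBdisj : ∀ i j, i ≠ j → Disjoint (B i) (B j))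
    (hsup : ∀ i u v, (Gs i).Adj u v → u ∈ B i ∧ v ∈ B i)
    (hH : ∀ u v, H.Adj u v ↔ G.Adj u v ∨ ∃ i, (Gs i).Adj u v)
    {i : Fin n} {u v : V} (hu : u ∈ B i) (hv : v ∈ B i) (h : H.Adj u v) : (Gs i).Adj u v := by
  by_cases hux : u = x i
  · by_cases hvx : v = x i
    · subst hux; subst hvx; exact absurd h H.irrefl
    · exact (att_off hGsupp hxB hBdisj hsup hH hv hvx h.symm).symm
  · exact att_off hGsupp hxB hBdisj hsup hH hu hux h

lemma att_noHole (hGsupp : ∀ u v, G.Adj u v → (∃ i, u = x i) ∧ (∃ j, v = x j))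
    (hxB : ∀ i, x i ∈ B i) (hBdisj : ∀ i j, i ≠ j → Disjoint (B i) (B j))
    (hsup : ∀ i u v, (Gs i).Adj u v → u ∈ B i ∧ v ∈ B i)
    (hH : ∀ u v, H.Adj u v ↔ G.Adj u v ∨ ∃ i, (Gs i).Adj u v)
    (hgood : ∀ i, Good (Gs i) (B i) (x i))
    (A : Finset V) (hA : A ⊆ Finset.univ.biUnion B) (hxA : ∀ j, x j ∉ A) : NoHole H A := by
  have hne : ∀ u ∈ A, ∀ i, u ≠ x i := by
    rintro u hu i rfl; exact hxA i hu
  intro v hv a ha b hb D hD hDv hab hnab hva hvb hr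
  obtain ⟨i, -, hvi⟩ := Finset.mem_biUnion.1 (hA hv)
  have kva := att_off hGsupp hxB hBdisj hsup hH hvi (hne v hv i) hva
  have kvb := att_off hGsupp hxB hBdisj hsup hH hvi (hne v hv i) hvb
  have hle : ∀ u w, (Gs i).Adj u w → H.Adj u w := fun u w h => (hH u w).2 (Or.inr ⟨i, h⟩)
  refine (hgood i).2 v (Finset.mem_erase.2 ⟨hne v hv i, hvi⟩)
    a (Finset.mem_erase.2 ⟨hne a ha i, (hsup _ _ _ kva).2⟩)
    b (Finset.mem_erase.2 ⟨hne b hb i, (hsup _ _ _ kvb).2⟩) (D ∩ B i) ?_ ?_ hab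
    (fun h => hnab (hle _ _ h)) kva kvb ?_
  · intro u hu
    rw [Finset.mem_inter] at hu
    exact Finset.mem_erase.2 ⟨hne u (hD hu.1) i, hu.2⟩
  · intro d hd
    rw [Finset.mem_inter] at hd
    exact ⟨(hDv d hd.1).1, fun h => (hDv d hd.1).2 (hle _ _ h)⟩
  · obtain ⟨W⟩ := hr
    have hTA : ∀ u, u ∈ {u | u ∈ D ∨ u = a ∨ u = b} → u ∈ A := by
      rintro u (h | h | h)
      · exact hD h
      · rwa [h]
      · rwa [h]
    have hTB : ∀ u, u ∈ B i → u ∈ {u | u ∈ D ∨ u = a ∨ u = b} →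
        u ∈ {u | u ∈ D ∩ B i ∨ u = a ∨ u = b} := by
      rintro u hu (h | h)
      · exact Or.inl (Finset.mem_inter.2 ⟨h, hu⟩)
      · exact Or.inr h
    have key : ∀ {p q : V} (W : (restr H {u | u ∈ D ∨ u = a ∨ u = b}).Walk p q), p ∈ B i →
        (restr (Gs i) {u | u ∈ D ∩ B i ∨ u = a ∨ u = b}).Reachable p q := by
      intro p q W
      induction W with
      | nil => intro _; exact SimpleGraph.Reachable.refl _
      | cons hpq W ih =>
        intro hp
        have hk := att_off hGsupp hxB hBdisj hsup hH hp (hne _ (hTA _ hpq.2.1) i) hpq.1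
        have hq := (hsup _ _ _ hk).2
        refine SimpleGraph.Reachable.trans (SimpleGraph.Adj.reachable ?_) (ih hq)
        exact ⟨hk, hTB _ hp hpq.2.1, hTB _ hq hpq.2.2⟩
    exact key W (hsup _ _ _ kva).2

lemma att_vd (hGsupp : ∀ u v, G.Adj u v → (∃ i, u = x i) ∧ (∃ j, v = x j))
    (hxB : ∀ i, x i ∈ B i) (hBdisj : ∀ i j, i ≠ j → Disjoint (B i) (B j))
    (hsup : ∀ i u v, (Gs i).Adj u v → u ∈ B i ∧ v ∈ B i)
    (hH : ∀ u v, H.Adj u v ↔ G.Adj u v ∨ ∃ i, (Gs i).Adj u v)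
    (hgood : ∀ i, Good (Gs i) (B i) (x i)) : ∀ (k : ℕ) (J : Finset (Fin n)), J.card ≤ k →
    ∀ A : Finset V, A ⊆ Finset.univ.biUnion B → (∀ j ∈ J, B j ⊆ A) → (∀ j ∉ J, x j ∉ A) →
    VertexDecomposableOn H A := by
  classical
  have hle : ∀ i u w, (Gs i).Adj u w → H.Adj u w := fun i u w h => (hH u w).2 (Or.inr ⟨i, h⟩)
  have base : ∀ A : Finset V, A ⊆ Finset.univ.biUnion B → (∀ j, x j ∉ A) →
      VertexDecomposableOn H A := fun A hA hxA => vd_of_noHole _ A le_rfl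
        (att_noHole hGsupp hxB hBdisj hsup hH hgood A hA hxA)
  intro k
  induction k with
  | zero =>
    intro J hJ A hA _ hxA
    have : J = ∅ := by simpa using hJ
    subst this
    exact base A hA (fun j => hxA j (by simp))
  | succ k ih =>
    intro J hJ A hA hJA hxA
    rcases J.eq_empty_or_nonempty with rfl | ⟨i, hi⟩
    · exact base A hA (fun j => hxA j (by simp))
    have hcard : (J.erase i).card ≤ k := by
      rw [Finset.card_erase_of_mem hi]; omega
    refine .shed A (x i) (hJA i hi (hxB i)) ?_ ?_ ?_
    · refine ih ((J.erase i).filter (fun j => ¬ H.Adj (x i) (x j)))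
        ((Finset.card_le_card (Finset.filter_subset _ _)).trans hcard) _
        (fun u hu => hA (mem_dcn.1 hu).1) ?_ ?_
      · intro j hj u hu
        rw [Finset.mem_filter, Finset.mem_erase] at hj
        obtain ⟨⟨hji, hjJ⟩, hadj⟩ := hj
        refine mem_dcn.2 ⟨hJA j hjJ hu, ?_, ?_⟩
        · rintro rfl
          exact hji (att_idx hBdisj hu (hxB i))
        · intro h
          by_cases hux : u = x j
          · subst hux; exact hadj h
          · have := att_off hGsupp hxB hBdisj hsup hH hu hux h.symm
            exact hji (att_idx hBdisj (hsup _ _ _ this).2 (hxB i))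
      · intro j hj hxj
        obtain ⟨h1, h2, h3⟩ := mem_dcn.1 hxj
        apply hj
        rw [Finset.mem_filter, Finset.mem_erase]
        refine ⟨⟨?_, ?_⟩, h3⟩
        · rintro rfl; exact h2 rfl
        · by_contra hjJ
          exact hxA j hjJ h1
    · refine ih (J.erase i) hcard _ ((Finset.erase_subset _ _).trans hA) ?_ ?_
      · intro j hj u hu
        rw [Finset.mem_erase] at hj ⊢
        refine ⟨?_, hJA j hj.2 hu⟩
        rintro rfl
        exact hj.1 (att_idx hBdisj hu (hxB i))
      · intro j hj hxj
        rw [Finset.mem_erase] at hxj hj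
        refine hxA j (fun h => hj ⟨?_, h⟩) hxj.2
        rintro rfl; exact hxj.1 rfl
    · intro S hS
      have hS1 : ∀ s ∈ S, s ∈ A ∧ s ≠ x i ∧ ¬ H.Adj (x i) s := fun s hs => mem_dcn.1 (hS.1 hs)
      obtain ⟨y, hy, hxy, hyS⟩ := (hgood i).1 (S ∩ B i) Finset.inter_subset_right
        (fun s hs => by
          have := hS1 s (Finset.mem_inter.1 hs).1
          exact ⟨this.2.1, fun h => this.2.2 (hle _ _ _ h)⟩)
        (fun u hu v hv h => hS.2 u (Finset.mem_inter.1 hu).1 v (Finset.mem_inter.1 hv).1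
          (hle _ _ _ h))
      have hyS' : ∀ s ∈ S, ¬ H.Adj y s := by
        intro s hs h
        have h' := att_off hGsupp hxB hBdisj hsup hH hy hxy.ne' h
        exact hyS s (Finset.mem_inter.2 ⟨hs, (hsup _ _ _ h').2⟩) h'
      refine ⟨y, hJA i hi hy, hle _ _ _ hxy, ?_, ?_⟩
      · intro s hs
        rcases Finset.mem_insert.1 hs with rfl | hs
        · exact Finset.mem_erase.2 ⟨hxy.ne', hJA i hi hy⟩
        · exact Finset.mem_erase.2 ⟨(hS1 s hs).2.1, (hS1 s hs).1⟩
      · intro a ha b hb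
        rcases Finset.mem_insert.1 ha with h1 | h1 <;> rcases Finset.mem_insert.1 hb with h2 | h2
        · rw [h1, h2]; exact H.irrefl
        · rw [h1]; exact hyS' b h2
        · rw [h2]; exact fun h => hyS' a h1 h.symm
        · exact hS.2 a h1 b h2

/-- If the attachment graph is vertex decomposable, so is each attached graph. -/
lemma att_part (hGsupp : ∀ u v, G.Adj u v → (∃ i, u = x i) ∧ (∃ j, v = x j))
    (hxB : ∀ i, x i ∈ B i) (hBdisj : ∀ i j, i ≠ j → Disjoint (B i) (B j))
    (hsup : ∀ i u v, (Gs i).Adj u v → u ∈ B i ∧ v ∈ B i)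
    (hH : ∀ u v, H.Adj u v ↔ G.Adj u v ∨ ∃ i, (Gs i).Adj u v)
    (hnb : ∀ i, ∃ y, (Gs i).Adj (x i) y)
    (hvd : VertexDecomposableOn H (Finset.univ.biUnion B)) (i : Fin n) :
    VertexDecomposableOn H (B i) := by
  classical
  choose y hy using hnb
  have hle : ∀ i u w, (Gs i).Adj u w → H.Adj u w := fun i u w h => (hH u w).2 (Or.inr ⟨i, h⟩)
  have step : ∀ J : Finset (Fin n), i ∉ J → ∃ A : Finset V, VertexDecomposableOn H A ∧
      A ⊆ Finset.univ.biUnion B ∧ (∀ j ∉ J, B j ⊆ A) ∧ (∀ j ∈ J, x j ∉ A) := by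
    intro J
    induction J using Finset.induction_on with
    | empty => 
      intro _
      exact ⟨_, hvd, subset_rfl, fun j _ => Finset.subset_biUnion_of_mem B (Finset.mem_univ j),
        by simp⟩
    | insert a J ha ih =>
      intro hiJ
      simp only [Finset.mem_insert, not_or] at hiJ
      obtain ⟨A, h1, h2, h3, h4⟩ := ih hiJ.2
      have hyB := (hsup _ _ _ (hy a)).2
      refine ⟨delClosedNbhd H A (y a), vd_link h1 _ (h3 a ha hyB),
        fun u hu => h2 (mem_dcn.1 hu).1, ?_, ?_⟩
      · intro j hj u hu
        simp only [Finset.mem_insert, not_or] at hj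
        refine mem_dcn.2 ⟨h3 j hj.2 hu, ?_, ?_⟩
        · rintro rfl
          exact hj.1 (att_idx hBdisj hu hyB)
        · intro h
          have := att_off hGsupp hxB hBdisj hsup hH hyB (hy a).ne' h
          exact hj.1 (att_idx hBdisj hu (hsup _ _ _ this).2)
      · intro j hj hxj
        obtain ⟨m1, m2, m3⟩ := mem_dcn.1 hxj
        rcases Finset.mem_insert.1 hj with rfl | hj
        · exact m3 (hle _ _ _ (hy j)).symm
        · exact h4 j hj m1
  obtain ⟨A, h1, h2, h3, h4⟩ := step (Finset.univ.erase i) (by simp)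
  refine vd_part (B i) _ A le_rfl h1 (h3 i (by simp)) ?_
  intro u hu v hv hvi h
  obtain ⟨j, -, hvj⟩ := Finset.mem_biUnion.1 (h2 hv)
  have hji : j ≠ i := by rintro rfl; exact hvi hvj
  have hvx : v ≠ x j := by
    rintro rfl
    exact h4 j (by simp [hji]) hv
  have := att_off hGsupp hxB hBdisj hsup hH hvj hvx h.symm
  exact hji (att_idx hBdisj (hsup _ _ _ this).2 hu)

end attach

/-- the attachment graph `G(C_1, …, C_t, G_{t+1}, …, G_n)` is vertex
decomposable iff every cycle has length 3 or 5. -/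
theorem stmt_16 {V : Type*} [DecidableEq V] (n t : ℕ) (ht : t ≤ n) (x : Fin n → V)
    (B : Fin n → Finset V) (G : SimpleGraph V) (Gs : Fin n → SimpleGraph V)
    (ℓ : Fin n → ℕ)
    (hxinj : Function.Injective x)
    (hGsupp : ∀ u v, G.Adj u v → (∃ i, u = x i) ∧ (∃ j, v = x j))
    -- `G` has no isolated vertex
    (hnoiso : ∀ i, ∃ u, G.Adj (x i) u)
    (hxB : ∀ i, x i ∈ B i)
    (hBdisj : ∀ i j, i ≠ j → Disjoint (B i) (B j))
    -- for `i < t`, `Gs i` is a cycle graph of length `ℓ i ≥ 3` on the vertex set `B i`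
    (hcyc : ∀ i : Fin n, (i : ℕ) < t → 3 ≤ ℓ i ∧ IsCycleGraphOn (Gs i) (B i) (ℓ i))
    -- for `i ≥ t`, `Gs i` is a connected chordal graph with at least two vertices,
    -- attached to `G` at a neighbor `x i` of a simplicial vertex `z` of `Gs i`
    (hBcard : ∀ i : Fin n, t ≤ (i : ℕ) → 2 ≤ (B i).card)
    (hGssupp : ∀ i : Fin n, t ≤ (i : ℕ) → ∀ u v, (Gs i).Adj u v → u ∈ B i ∧ v ∈ B i)
    (hconn : ∀ i : Fin n, t ≤ (i : ℕ) → ((Gs i).induce ((B i : Set V))).Connected)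
    (hchordal : ∀ i : Fin n, t ≤ (i : ℕ) → IsChordal (Gs i))
    (hsimp : ∀ i : Fin n, t ≤ (i : ℕ) → ∃ z ∈ B i,
      (∀ u v, (Gs i).Adj z u → (Gs i).Adj z v → u ≠ v → (Gs i).Adj u v) ∧
      (Gs i).Adj z (x i)) :
    VertexDecomposableOn (G ⊔ ⨆ i, Gs i) (Finset.univ.biUnion B) ↔
      ∀ i : Fin n, (i : ℕ) < t → ℓ i = 3 ∨ ℓ i = 5 := by
  have hsup : ∀ i u v, (Gs i).Adj u v → u ∈ B i ∧ v ∈ B i := by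
    intro i
    rcases Nat.lt_or_ge (i : ℕ) t with hi | hi
    · exact (hcyc i hi).2.1
    · exact hGssupp i hi
  have hH : ∀ u v, (G ⊔ ⨆ i, Gs i).Adj u v ↔ G.Adj u v ∨ ∃ i, (Gs i).Adj u v := by
    intro u v
    rw [SimpleGraph.sup_adj, SimpleGraph.iSup_adj]
  constructor
  · intro hvd i hi
    by_contra hcon
    push Not at hcon
    have hnb : ∀ i, ∃ y, (Gs i).Adj (x i) y := by
      intro i
      rcases Nat.lt_or_ge (i : ℕ) t with hi | hi
      · obtain ⟨h3, hc⟩ := hcyc i hi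
        obtain ⟨f, hfB, hfs, hfi, hadj⟩ := cyc_param hc
        obtain ⟨j, hj⟩ := hfs _ (hxB i)
        obtain ⟨k, hk⟩ : ∃ k, ℓ i = k + 2 := ⟨ℓ i - 2, by omega⟩
        have : ∃ j', (SimpleGraph.cycleGraph (ℓ i)).Adj j j' := by
          clear hj hadj hfi hfs hfB f hc
          revert j
          rw [hk]
          intro j
          exact ⟨j + 1, by rw [SimpleGraph.cycleGraph_adj]; simp⟩
        obtain ⟨j', hj'⟩ := this
        exact ⟨f j', by rw [← hj, hadj]; exact hj'⟩
      · obtain ⟨z, _, _, hz⟩ := hsimp i hi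
        exact ⟨z, hz.symm⟩
    have := att_part hGsupp hxB hBdisj hsup hH hnb hvd i
    refine not_vd_cycle (hcyc i hi).1 hcon.1 hcon.2 (hcyc i hi).2 ?_ this
    intro u hu v hv
    exact ⟨att_in hGsupp hxB hBdisj hsup hH hu hv, fun h => (hH u v).2 (Or.inr ⟨i, h⟩)⟩
  · intro hℓ
    refine att_vd hGsupp hxB hBdisj hsup hH ?_ _ Finset.univ le_rfl _ subset_rfl
      (fun j _ => Finset.subset_biUnion_of_mem B (Finset.mem_univ j)) (by simp)
    intro i
    rcases Nat.lt_or_ge (i : ℕ) t with hi | hi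
    · have hc := (hcyc i hi).2
      rcases hℓ i hi with h | h
      · rw [h] at hc; exact good_cycle3 (hxB i) hc
      · rw [h] at hc; exact good_cycle5 (hxB i) hc
    · exact good_of_chordal (hchordal i hi) (hsimp i hi)
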